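/- Let G be a group and let a, a′, b, c : ZMod 6 → G be families of elements of G, together with elements ρ, R ∈ G, satisfying for every i ∈ ZMod 6: Ra(i)R⁻¹ = a(i+1), Ra′(i)R⁻¹ = a′(i+1), Rb(i)R⁻¹ = b(i+1), Rc(i)R⁻¹ = c(i+1), and also ρb(3)ρ⁻¹ = b(5) and ρc(5)ρ⁻¹ = c(2). Define K₁ = a(1)c(1)b(3)b(4)⁻¹c(5)⁻¹a′(6)⁻¹, K₂ = RK₁R⁻¹, K₃ = (K₂K₁)K₂(K₂K₁)⁻¹, K₄ = (K₁K₂)K₁(K₁K₂)⁻¹, K₅ = R²K₃R⁻², K₆ = K₅⁻¹, K₇ = (K₆K₄)K₆(K₆K₄)⁻¹, K₈ = K₄K₇⁻¹, K₉ = K₈⁻¹, K₁₀ = (K₉K₃)K₉(K₉K₃)⁻¹, K₁₁ = R²K₁₀R⁻², K₁₂ = K₁₁⁻¹, K₁₃ = (K₁₂K₁₀)K₁₂(K₁₂K₁₀)⁻¹ and K₁₄ = (K₁₃K₃)K₁₃(K₁₃K₃)⁻¹. Assume the conjugation relations: conjugation by K₂K₁ fixes a(2), b(4), c(6), a′(1)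 and sends c(2) to b(3) and b(5) to c(5); conjugation by K₁K₂ fixes a(1), c(1), b(4), a′(6) and sends b(3) to c(2) and c(5) to b(5); conjugation by K₆K₄ fixes a′(3), c(2), c(1), b(5) and sends b(6) to a′(6) and a(4) to b(4); conjugation by K₉K₃ fixes a(1) and sends a′(3) to b(3); conjugation by K₁₂K₁₀ fixes b(5) and sends a(3) to b(3); conjugation by K₁₃K₃ fixes b(3) and sends b(5) to c(5). Assume moreover that a′(6) commutes with b(4) and with b(5), that b(4) commutes with b(5), and that c(1) commutes with c(2). Then the subgroup of G generated by ρ, R and K₁ contains the elements a(1)a(2)⁻¹, b(1)b(2)⁻¹ and c(1)c(2)⁻¹. -/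

import Mathlib

theorem semiconjBy_iff_conj_eq {G : Type*} [Group G] {f x y : G} :
    SemiconjBy f x y ↔ f * x * f⁻¹ = y :=
  mul_inv_eq_iff_eq_mul.symm

theorem eq_of_eq_conj_of_semiconjBy {G : Type*} [Group G] {f x u v y : G}
    (hy : y = f * x * f⁻¹) (hx : x = u) (h : SemiconjBy f u v) : y = v := by
  rw [hy, hx]
  exact semiconjBy_iff_conj_eq.1 h

theorem Subgroup.conj_mem_of_mem {G : Type*} [Group G] {H : Subgroup G} {f x : G}
    (hf : f ∈ H) (hx : x ∈ H) : f * x * f⁻¹ ∈ H :=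
  H.mul_mem (H.mul_mem hf hx) (H.inv_mem hf)

theorem Subgroup.mul_inv_mem_trans {G : Type*} [Group G] {H : Subgroup G} {x y z : G}
    (hxy : x * y⁻¹ ∈ H) (hyz : y * z⁻¹ ∈ H) : x * z⁻¹ ∈ H := by
  simpa [mul_assoc] using H.mul_mem hxy hyz

theorem Subgroup.mul_inv_mem_symm {G : Type*} [Group G] {H : Subgroup G} {x y : G}
    (hxy : x * y⁻¹ ∈ H) : y * x⁻¹ ∈ H := by
  simpa using H.inv_mem hxy

theorem Subgroup.mul_inv_mem_of_semiconjBy {G : Type*} [Group G] {H : Subgroup G}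
    {f x y x' y' : G} (hf : f ∈ H) (hx : SemiconjBy f x x') (hy : SemiconjBy f y y')
    (hxy : x * y⁻¹ ∈ H) : x' * y'⁻¹ ∈ H := by
  rw [← semiconjBy_iff_conj_eq.1 (hx.mul_right hy.inv_right)]
  exact H.conj_mem_of_mem hf hxy

/-- Abstract group-theoretic core of Lemma 5 of the paper (the case `n = 6`). -/
theorem lemma5_abstract {G : Type*} [Group G]
    (a a' b c : ZMod 6 → G) (ρ R : G)
    (hRa : ∀ i, R * a i * R⁻¹ = a (i + 1))
    (hRa' : ∀ i, R * a' i * R⁻¹ = a' (i + 1))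
    (hRb : ∀ i, R * b i * R⁻¹ = b (i + 1))
    (hRc : ∀ i, R * c i * R⁻¹ = c (i + 1))
    (hρb : ρ * b 3 * ρ⁻¹ = b 5)
    (hρc : ρ * c 5 * ρ⁻¹ = c 2)
    (K₁ K₂ K₃ K₄ K₅ K₆ K₇ K₈ K₉ K₁₀ K₁₁ K₁₂ K₁₃ K₁₄ : G)
    (hK₁ : K₁ = a 1 * c 1 * b 3 * (b 4)⁻¹ * (c 5)⁻¹ * (a' 6)⁻¹)
    (hK₂ : K₂ = R * K₁ * R⁻¹)
    (hK₃ : K₃ = (K₂ * K₁) * K₂ * (K₂ * K₁)⁻¹)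
    (hK₄ : K₄ = (K₁ * K₂) * K₁ * (K₁ * K₂)⁻¹)
    (hK₅ : K₅ = R ^ 2 * K₃ * (R ^ 2)⁻¹)
    (hK₆ : K₆ = K₅⁻¹)
    (hK₇ : K₇ = (K₆ * K₄) * K₆ * (K₆ * K₄)⁻¹)
    (hK₈ : K₈ = K₄ * K₇⁻¹)
    (hK₉ : K₉ = K₈⁻¹)
    (hK₁₀ : K₁₀ = (K₉ * K₃) * K₉ * (K₉ * K₃)⁻¹)
    (hK₁₁ : K₁₁ = R ^ 2 * K₁₀ * (R ^ 2)⁻¹)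
    (hK₁₂ : K₁₂ = K₁₁⁻¹)
    (hK₁₃ : K₁₃ = (K₁₂ * K₁₀) * K₁₂ * (K₁₂ * K₁₀)⁻¹)
    (hK₁₄ : K₁₄ = (K₁₃ * K₃) * K₁₃ * (K₁₃ * K₃)⁻¹)
    (h21a : (K₂ * K₁) * a 2 * (K₂ * K₁)⁻¹ = a 2)
    (h21b : (K₂ * K₁) * b 4 * (K₂ * K₁)⁻¹ = b 4)
    (h21c : (K₂ * K₁) * c 6 * (K₂ * K₁)⁻¹ = c 6)
    (h21a' : (K₂ * K₁) * a' 1 * (K₂ * K₁)⁻¹ = a' 1)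
    (h21cb : (K₂ * K₁) * c 2 * (K₂ * K₁)⁻¹ = b 3)
    (h21bc : (K₂ * K₁) * b 5 * (K₂ * K₁)⁻¹ = c 5)
    (h12a : (K₁ * K₂) * a 1 * (K₁ * K₂)⁻¹ = a 1)
    (h12c1 : (K₁ * K₂) * c 1 * (K₁ * K₂)⁻¹ = c 1)
    (h12b4 : (K₁ * K₂) * b 4 * (K₁ * K₂)⁻¹ = b 4)
    (h12a' : (K₁ * K₂) * a' 6 * (K₁ * K₂)⁻¹ = a' 6)
    (h12bc : (K₁ * K₂) * b 3 * (K₁ * K₂)⁻¹ = c 2)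
    (h12cb : (K₁ * K₂) * c 5 * (K₁ * K₂)⁻¹ = b 5)
    (h64a' : (K₆ * K₄) * a' 3 * (K₆ * K₄)⁻¹ = a' 3)
    (h64c2 : (K₆ * K₄) * c 2 * (K₆ * K₄)⁻¹ = c 2)
    (h64c1 : (K₆ * K₄) * c 1 * (K₆ * K₄)⁻¹ = c 1)
    (h64b5 : (K₆ * K₄) * b 5 * (K₆ * K₄)⁻¹ = b 5)
    (h64ba : (K₆ * K₄) * b 6 * (K₆ * K₄)⁻¹ = a' 6)
    (h64ab : (K₆ * K₄) * a 4 * (K₆ * K₄)⁻¹ = b 4)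
    (h93a : (K₉ * K₃) * a 1 * (K₉ * K₃)⁻¹ = a 1)
    (h93ab : (K₉ * K₃) * a' 3 * (K₉ * K₃)⁻¹ = b 3)
    (h1210b : (K₁₂ * K₁₀) * b 5 * (K₁₂ * K₁₀)⁻¹ = b 5)
    (h1210ab : (K₁₂ * K₁₀) * a 3 * (K₁₂ * K₁₀)⁻¹ = b 3)
    (h133b : (K₁₃ * K₃) * b 3 * (K₁₃ * K₃)⁻¹ = b 3)
    (h133bc : (K₁₃ * K₃) * b 5 * (K₁₃ * K₃)⁻¹ = c 5)
    (hc₁ : Commute (a' 6) (b 4)) (hc₂ : Commute (a' 6) (b 5))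
    (hc₃ : Commute (b 4) (b 5)) (hc₄ : Commute (c 1) (c 2)) :
    a 1 * (a 2)⁻¹ ∈ Subgroup.closure ({ρ, R, K₁} : Set G) ∧
    b 1 * (b 2)⁻¹ ∈ Subgroup.closure ({ρ, R, K₁} : Set G) ∧
    c 1 * (c 2)⁻¹ ∈ Subgroup.closure ({ρ, R, K₁} : Set G) := by
  simp only [← semiconjBy_iff_conj_eq] at *
  have shift_two {x : ZMod 6 → G} (hx : ∀ i, SemiconjBy R (x i) (x (i + 1))) (i : ZMod 6) :
      SemiconjBy (R ^ 2) (x i) (x (i + 2)) := by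
    have h := (hx (i + 1)).mul_left (hx i)
    rwa [← pow_two, add_assoc, one_add_one_eq_two] at h
  have e₂ : K₂ = a 2 * c 2 * b 4 * (b 5)⁻¹ * (c 6)⁻¹ * (a' 1)⁻¹ :=
    eq_of_eq_conj_of_semiconjBy hK₂ hK₁ <|
      ((((((hRa 1).mul_right (hRc 1)).mul_right (hRb 3)).mul_right (hRb 4).inv_right).mul_right
        (hRc 5).inv_right).mul_right (hRa' 6).inv_right)
  have e₃ : K₃ = a 2 * b 3 * b 4 * (c 5)⁻¹ * (c 6)⁻¹ * (a' 1)⁻¹ :=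
    eq_of_eq_conj_of_semiconjBy hK₃ e₂ <|
      (((((h21a.mul_right h21cb).mul_right h21b).mul_right h21bc.inv_right).mul_right
        h21c.inv_right).mul_right h21a'.inv_right)
  have e₄ : K₄ = a 1 * c 1 * c 2 * (b 4)⁻¹ * (b 5)⁻¹ * (a' 6)⁻¹ :=
    eq_of_eq_conj_of_semiconjBy hK₄ hK₁ <|
      (((((h12a.mul_right h12c1).mul_right h12bc).mul_right h12b4.inv_right).mul_right
        h12cb.inv_right).mul_right h12a'.inv_right)
  have e₅ : K₅ = a 4 * b 5 * b 6 * (c 1)⁻¹ * (c 2)⁻¹ * (a' 3)⁻¹ :=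
    eq_of_eq_conj_of_semiconjBy hK₅ e₃ <|
      ((((((shift_two hRa 2).mul_right (shift_two hRb 3)).mul_right (shift_two hRb 4)).mul_right
        (shift_two hRc 5).inv_right).mul_right (shift_two hRc 6).inv_right).mul_right
          (shift_two hRa' 1).inv_right)
  have e₆ : K₆ = a' 3 * c 2 * c 1 * (b 6)⁻¹ * (b 5)⁻¹ * (a 4)⁻¹ := by
    rw [hK₆, e₅]; group
  have e₇ : K₇ = a' 3 * c 2 * c 1 * (a' 6)⁻¹ * (b 5)⁻¹ * (b 4)⁻¹ :=
    eq_of_eq_conj_of_semiconjBy hK₇ e₆ <|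
      (((((h64a'.mul_right h64c2).mul_right h64c1).mul_right h64ba.inv_right).mul_right
        h64b5.inv_right).mul_right h64ab.inv_right)
  have e₈ : K₈ = a 1 * (a' 3)⁻¹ := by
    have e : (b 4)⁻¹ * (b 5)⁻¹ * (a' 6)⁻¹ = (a' 6)⁻¹ * (b 5)⁻¹ * (b 4)⁻¹ := by
      rw [hc₃.inv_inv.eq, mul_assoc, hc₁.symm.inv_inv.eq, ← mul_assoc, hc₂.symm.inv_inv.eq]
    calc K₈ = a 1 * (c 1 * c 2) * ((b 4)⁻¹ * (b 5)⁻¹ * (a' 6)⁻¹) *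
          (a' 3 * c 2 * c 1 * (a' 6)⁻¹ * (b 5)⁻¹ * (b 4)⁻¹)⁻¹ := by
          rw [hK₈, e₄, e₇]; simp only [mul_assoc]
      _ = a 1 * (a' 3)⁻¹ := by rw [e, hc₄.eq]; group
  have e₉ : K₉ = a' 3 * (a 1)⁻¹ := by
    rw [hK₉, e₈]; group
  have e₁₀ : K₁₀ = b 3 * (a 1)⁻¹ :=
    eq_of_eq_conj_of_semiconjBy hK₁₀ e₉ (h93ab.mul_right h93a.inv_right)
  have e₁₁ : K₁₁ = b 5 * (a 3)⁻¹ :=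
    eq_of_eq_conj_of_semiconjBy hK₁₁ e₁₀
      ((shift_two hRb 3).mul_right (shift_two hRa 1).inv_right)
  have e₁₂ : K₁₂ = a 3 * (b 5)⁻¹ := by
    rw [hK₁₂, e₁₁]; group
  have e₁₃ : K₁₃ = b 3 * (b 5)⁻¹ :=
    eq_of_eq_conj_of_semiconjBy hK₁₃ e₁₂ (h1210ab.mul_right h1210b.inv_right)
  have e₁₄ : K₁₄ = b 3 * (c 5)⁻¹ :=
    eq_of_eq_conj_of_semiconjBy hK₁₄ e₁₃ (h133b.mul_right h133bc.inv_right)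
  set H := Subgroup.closure ({ρ, R, K₁} : Set G)
  have mρ : ρ ∈ H := Subgroup.subset_closure (by simp)
  have mR : R ∈ H := Subgroup.subset_closure (by simp)
  have m₁ : K₁ ∈ H := Subgroup.subset_closure (by simp)
  have mR₂ : R ^ 2 ∈ H := H.pow_mem mR 2
  have m₂ : K₂ ∈ H := hK₂ ▸ H.conj_mem_of_mem mR m₁
  have m₃ : K₃ ∈ H := hK₃ ▸ H.conj_mem_of_mem (H.mul_mem m₂ m₁) m₂
  have m₄ : K₄ ∈ H := hK₄ ▸ H.conj_mem_of_mem (H.mul_mem m₁ m₂) m₁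
  have m₆ : K₆ ∈ H := hK₆ ▸ H.inv_mem (hK₅ ▸ H.conj_mem_of_mem mR₂ m₃)
  have m₇ : K₇ ∈ H := hK₇ ▸ H.conj_mem_of_mem (H.mul_mem m₆ m₄) m₆
  have m₉ : K₉ ∈ H := hK₉ ▸ H.inv_mem (hK₈ ▸ H.mul_mem m₄ (H.inv_mem m₇))
  have m₁₀ : K₁₀ ∈ H := hK₁₀ ▸ H.conj_mem_of_mem (H.mul_mem m₉ m₃) m₉
  have m₁₂ : K₁₂ ∈ H := hK₁₂ ▸ H.inv_mem (hK₁₁ ▸ H.conj_mem_of_mem mR₂ m₁₀)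
  have m₁₃ : K₁₃ ∈ H := hK₁₃ ▸ H.conj_mem_of_mem (H.mul_mem m₁₂ m₁₀) m₁₂
  have m₁₄ : K₁₄ ∈ H := hK₁₄ ▸ H.conj_mem_of_mem (H.mul_mem m₁₃ m₃) m₁₃
  have shift {x y : ZMod 6 → G} (hx : ∀ i, SemiconjBy R (x i) (x (i + 1)))
      (hy : ∀ i, SemiconjBy R (y i) (y (i + 1))) {i j : ZMod 6} (h : x i * (y j)⁻¹ ∈ H) :
      x (i + 1) * (y (j + 1))⁻¹ ∈ H :=
    Subgroup.mul_inv_mem_of_semiconjBy mR (hx i) (hy j) h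
  have ba : b 3 * (a 1)⁻¹ ∈ H := e₁₀ ▸ m₁₀
  have bb : b 3 * (b 5)⁻¹ ∈ H := e₁₃ ▸ m₁₃
  have bc : b 3 * (c 5)⁻¹ ∈ H := e₁₄ ▸ m₁₄
  have bc' : b 5 * (c 2)⁻¹ ∈ H := Subgroup.mul_inv_mem_of_semiconjBy mρ hρb hρc bc
  have ba' : b 4 * (a 2)⁻¹ ∈ H := shift hRb hRa ba
  have b46 : b 4 * (b 6)⁻¹ ∈ H := shift hRb hRb bb
  have b51 : b 5 * (b 1)⁻¹ ∈ H := shift hRb hRb b46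
  have b62 : b 6 * (b 2)⁻¹ ∈ H := shift hRb hRb b51
  have b4c6 : b 4 * (c 6)⁻¹ ∈ H := shift hRb hRc bc
  have b5c1 : b 5 * (c 1)⁻¹ ∈ H := shift hRb hRc b4c6
  have c12 : c 1 * (c 2)⁻¹ ∈ H := Subgroup.mul_inv_mem_trans (Subgroup.mul_inv_mem_symm b5c1) bc'
  have b6c2 : b 6 * (c 2)⁻¹ ∈ H := shift hRb hRc b5c1
  have b56 : b 5 * (b 6)⁻¹ ∈ H :=
    Subgroup.mul_inv_mem_trans bc' (Subgroup.mul_inv_mem_symm b6c2)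
  have b34 : b 3 * (b 4)⁻¹ ∈ H := Subgroup.mul_inv_mem_trans bb
    (Subgroup.mul_inv_mem_trans b56 (Subgroup.mul_inv_mem_symm b46))
  exact ⟨Subgroup.mul_inv_mem_trans (Subgroup.mul_inv_mem_symm ba)
      (Subgroup.mul_inv_mem_trans b34 ba'),
    Subgroup.mul_inv_mem_trans (Subgroup.mul_inv_mem_symm b51)
      (Subgroup.mul_inv_mem_trans b56 b62), c12⟩
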